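/- Let (X,d,m) be a metric measure space, p ∈ (1,∞) with conjugate exponent p' = p/(p−1), and fix x0 ∈ X. Assume that for every λ > 0 the integral ∫_X exp(−pλ d(x0,x)^{p'}) dm(x) is finite, and that there exists a constant C > 0, independent of k, such that for every k ∈ ℕ and every Lipschitz function u : X → ℝ with bounded support, (∫_X d(x0,x)^{p'k} (lip u(x))^p dm)(∫_X d(x0,x)^{p'(k+1)} |u(x)|^p dm)^{p−1} ≥ ((C+k)/(p−1))^p (∫_X d(x0,x)^{p'k} |u(x)|^p dm)^p. Then for every ℓ ∈ ℕ the function ρ ↦ m^{ℓ,p}(B_ρ(x0))/ρ^{p'(C+ℓ)} is non-decreasing on (0,∞), where m^{ℓ,p} is the measure with density d(x0,·)^{p'ℓ} with respect to m. -/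

import Mathlib

open MeasureTheory Filter Metric
open scoped ENNReal Topology NNReal

/-- The local Lipschitz constant `lip u (x) = limsup_{y → x} |u y - u x| / d(y,x)`. -/
noncomputable def lip {X : Type*} [MetricSpace X] (u : X → ℝ) (x : X) : ℝ :=
  Filter.limsup (fun y => |u y - u x| / dist y x) (𝓝[≠] x)

/-- The probability that a Poisson variable of mean `z` is at most `n`. -/
noncomputable def poissonCDFReal (n : ℕ) (z : ℝ) : ℝ :=
  Real.exp (-z) * ∑ k ∈ Finset.range (n + 1), z ^ k / k.factorial

lemma poissonCDFReal_nonneg (n : ℕ) {z : ℝ} (hz : 0 ≤ z) : 0 ≤ poissonCDFReal n z := by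
  unfold poissonCDFReal
  positivity

lemma poissonCDFReal_le_one (n : ℕ) {z : ℝ} (hz : 0 ≤ z) : poissonCDFReal n z ≤ 1 := by
  unfold poissonCDFReal
  calc _ ≤ Real.exp (-z) * Real.exp z := by
        gcongr
        exact Real.sum_le_exp_of_nonneg hz _
    _ = 1 := by rw [← Real.exp_add]; simp

lemma continuous_poissonCDFReal (n : ℕ) : Continuous (poissonCDFReal n) := by
  unfold poissonCDFReal
  fun_prop

lemma exp_neg_mul_pow_mul_exp (n : ℕ) (x : ℝ) :
    Real.exp (-(n * x)) * (x ^ n * Real.exp n) = (x * Real.exp (1 - x)) ^ n := by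
  rw [mul_pow, ← Real.exp_nat_mul, mul_left_comm, ← Real.exp_add]
  congr 2
  ring

lemma poissonCDFReal_le_pow (n : ℕ) {x : ℝ} (hx : 1 ≤ x) :
    poissonCDFReal n (n * x) ≤ (x * Real.exp (1 - x)) ^ n := by
  rw [← exp_neg_mul_pow_mul_exp]
  unfold poissonCDFReal
  gcongr
  calc ∑ k ∈ Finset.range (n + 1), (n * x) ^ k / (k.factorial : ℝ)
      ≤ ∑ k ∈ Finset.range (n + 1), x ^ n * ((n : ℝ) ^ k / (k.factorial : ℝ)) := by
        refine Finset.sum_le_sum fun k hk => ?_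
        rw [mul_pow, mul_comm ((n : ℝ) ^ k), mul_div_assoc]
        gcongr
        exact Nat.lt_succ_iff.1 (Finset.mem_range.1 hk)
    _ ≤ x ^ n * Real.exp n := by
        rw [← Finset.mul_sum]
        gcongr
        exact Real.sum_le_exp_of_nonneg (by positivity) _

lemma one_sub_pow_le_poissonCDFReal (n : ℕ) {x : ℝ} (hx0 : 0 ≤ x) (hx : x ≤ 1) :
    1 - (x * Real.exp (1 - x)) ^ n ≤ poissonCDFReal n (n * x) := by
  have key : Real.exp (n * x) ≤
      (∑ k ∈ Finset.range (n + 1), (n * x) ^ k / (k.factorial : ℝ)) + x ^ n * Real.exp n := by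
    have h1 := NormedSpace.expSeries_div_hasSum_exp (n * x : ℝ)
    have h2 := (NormedSpace.expSeries_div_hasSum_exp (n : ℝ)).mul_left (x ^ n)
    rw [← Real.exp_eq_exp_ℝ] at h1 h2
    have h3 : HasSum (fun k : ℕ => if k ∈ Finset.range (n + 1) then
        (n * x) ^ k / (k.factorial : ℝ) else 0)
        (∑ k ∈ Finset.range (n + 1), (n * x) ^ k / (k.factorial : ℝ)) := by
      convert! hasSum_sum_of_ne_finset_zero (s := Finset.range (n + 1))
        (f := fun k : ℕ => if k ∈ Finset.range (n + 1) then
          (n * x) ^ k / (k.factorial : ℝ) else 0) (L := SummationFilter.unconditional ℕ) ?_ using 1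
      · exact Finset.sum_congr rfl fun k hk => by rw [if_pos hk]
      · intro k hk
        rw [if_neg hk]
    refine hasSum_le (fun k => ?_) h1 (h3.add h2)
    split_ifs with hk
    · have : 0 ≤ x ^ n * ((n : ℝ) ^ k / (k.factorial : ℝ)) := by positivity
      linarith
    · rw [zero_add, mul_pow, mul_comm ((n : ℝ) ^ k), mul_div_assoc]
      refine mul_le_mul_of_nonneg_right (pow_le_pow_of_le_one hx0 hx ?_) (by positivity)
      simp at hk
      omega
  rw [← exp_neg_mul_pow_mul_exp]
  unfold poissonCDFReal
  have h := mul_le_mul_of_nonneg_left key (Real.exp_pos (-(n * x))).le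
  rw [← Real.exp_add, neg_add_cancel, Real.exp_zero, mul_add] at h
  linarith

lemma mul_exp_one_sub_lt_one {x : ℝ} (hx : x ≠ 1) : x * Real.exp (1 - x) < 1 := by
  have h := Real.add_one_lt_exp (sub_ne_zero.2 hx)
  calc x * Real.exp (1 - x) < Real.exp (x - 1) * Real.exp (1 - x) := by
        gcongr
        linarith
    _ = 1 := by rw [← Real.exp_add]; simp

lemma tendsto_mul_exp_one_sub_pow {x : ℝ} (hx0 : 0 ≤ x) (hx : x ≠ 1) :
    Tendsto (fun n : ℕ => (x * Real.exp (1 - x)) ^ n) atTop (𝓝 0) :=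
  tendsto_pow_atTop_nhds_zero_of_lt_one (by positivity) (mul_exp_one_sub_lt_one hx)

section Laplace

variable {Ω : Type*} [MeasurableSpace Ω] {μ : Measure Ω} {T : Ω → ℝ}

lemma neg_mem_interior_integrableExpSet
    (hexp : ∀ s : ℝ, 0 < s → Integrable (fun ω => Real.exp (-s * T ω)) μ) {s : ℝ} (hs : 0 < s) :
    -s ∈ interior (ProbabilityTheory.integrableExpSet T μ) := by
  refine mem_interior.2 ⟨Set.Iio 0, fun t ht => ?_, isOpen_Iio, by simpa using hs⟩
  simpa [ProbabilityTheory.integrableExpSet] using hexp (-t) (by simpa using ht)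

lemma integrable_pow_mul_exp_neg
    (hexp : ∀ s : ℝ, 0 < s → Integrable (fun ω => Real.exp (-s * T ω)) μ) {s : ℝ} (hs : 0 < s)
    (k : ℕ) : Integrable (fun ω => T ω ^ k * Real.exp (-s * T ω)) μ :=
  ProbabilityTheory.integrable_pow_mul_exp_of_mem_interior_integrableExpSet
    (neg_mem_interior_integrableExpSet hexp hs) k

lemma hasDerivAt_integral_pow_mul_exp_neg
    (hexp : ∀ s : ℝ, 0 < s → Integrable (fun ω => Real.exp (-s * T ω)) μ) {s : ℝ} (hs : 0 < s)
    (k : ℕ) : HasDerivAt (fun s => ∫ ω, T ω ^ k * Real.exp (-s * T ω) ∂μ)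
      (-∫ ω, T ω ^ (k + 1) * Real.exp (-s * T ω) ∂μ) s := by
  have h := ProbabilityTheory.hasDerivAt_integral_pow_mul_exp_real
    (neg_mem_interior_integrableExpSet hexp hs) k
  simpa [Function.comp_def] using h.scomp s (hasDerivAt_neg s)

lemma integral_poissonCDFReal
    (hexp : ∀ s : ℝ, 0 < s → Integrable (fun ω => Real.exp (-s * T ω)) μ) {s : ℝ} (hs : 0 < s)
    (n : ℕ) : ∫ ω, poissonCDFReal n (s * T ω) ∂μ =
      ∑ k ∈ Finset.range (n + 1),
        s ^ k / k.factorial * ∫ ω, T ω ^ k * Real.exp (-s * T ω) ∂μ := by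
  simp_rw [← integral_const_mul]
  rw [← integral_finsetSum _ fun k _ => (integrable_pow_mul_exp_neg hexp hs k).const_mul _]
  refine integral_congr_ae (Eventually.of_forall fun ω => ?_)
  simp only [poissonCDFReal, Finset.mul_sum]
  refine Finset.sum_congr rfl fun k _ => ?_
  rw [neg_mul, mul_pow]
  ring

lemma integrable_poissonCDFReal
    (hexp : ∀ s : ℝ, 0 < s → Integrable (fun ω => Real.exp (-s * T ω)) μ) {s : ℝ} (hs : 0 < s)
    (n : ℕ) : Integrable (fun ω => poissonCDFReal n (s * T ω)) μ := by
  have h := integrable_finsetSum (Finset.range (n + 1)) fun k _ =>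
    (integrable_pow_mul_exp_neg hexp hs k).const_mul (s ^ k / (k.factorial : ℝ))
  refine h.congr (Eventually.of_forall fun ω => ?_)
  simp only [poissonCDFReal, Finset.mul_sum]
  refine Finset.sum_congr rfl fun k _ => ?_
  rw [neg_mul, mul_pow]
  ring

lemma hasDerivAt_integral_poissonCDFReal
    (hexp : ∀ s : ℝ, 0 < s → Integrable (fun ω => Real.exp (-s * T ω)) μ) {s : ℝ} (hs : 0 < s)
    (n : ℕ) : HasDerivAt (fun s => ∫ ω, poissonCDFReal n (s * T ω) ∂μ)
      (-(s ^ n / n.factorial * ∫ ω, T ω ^ (n + 1) * Real.exp (-s * T ω) ∂μ)) s := by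
  have h : HasDerivAt (fun s : ℝ => ∑ k ∈ Finset.range (n + 1),
        s ^ k / k.factorial * ∫ ω, T ω ^ k * Real.exp (-s * T ω) ∂μ)
      (-(s ^ n / n.factorial * ∫ ω, T ω ^ (n + 1) * Real.exp (-s * T ω) ∂μ)) s := by
    induction n with
    | zero => simpa using hasDerivAt_integral_pow_mul_exp_neg hexp hs 0
    | succ n ih =>
      simp_rw [Finset.sum_range_succ _ (n + 1)]
      have h1 := ((hasDerivAt_pow (n + 1) s).div_const ((n + 1).factorial : ℝ)).mul
        (hasDerivAt_integral_pow_mul_exp_neg hexp hs (n + 1))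
      convert! ih.add h1 using 1
      have : ((n + 1).factorial : ℝ) = (n + 1) * n.factorial := by
        rw [Nat.factorial_succ]; push_cast; ring
      have h0 : (n.factorial : ℝ) ≠ 0 := by positivity
      rw [this]
      push_cast
      field_simp
      simp
  refine h.congr_of_eventuallyEq ?_
  filter_upwards [lt_mem_nhds hs] with t ht using integral_poissonCDFReal hexp ht n

lemma mul_integral_poissonCDFReal_le
    (hexp : ∀ s : ℝ, 0 < s → Integrable (fun ω => Real.exp (-s * T ω)) μ) {c : ℝ}
    (hmom : ∀ (k : ℕ) (s : ℝ), 0 < s → (c + k) * ∫ ω, T ω ^ k * Real.exp (-s * T ω) ∂μ ≤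
      s * ∫ ω, T ω ^ (k + 1) * Real.exp (-s * T ω) ∂μ) {s : ℝ} (hs : 0 < s) (n : ℕ) :
    c * ∫ ω, poissonCDFReal n (s * T ω) ∂μ ≤
      s ^ (n + 1) / n.factorial * ∫ ω, T ω ^ (n + 1) * Real.exp (-s * T ω) ∂μ := by
  rw [integral_poissonCDFReal hexp hs]
  induction n with
  | zero => simpa using hmom 0 s hs
  | succ n ih =>
    rw [Finset.sum_range_succ, mul_add]
    have h1 := mul_le_mul_of_nonneg_left (hmom (n + 1) s hs)
      (show 0 ≤ s ^ (n + 1) / ((n + 1).factorial : ℝ) by positivity)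
    have : ((n + 1).factorial : ℝ) = (n + 1) * n.factorial := by
      rw [Nat.factorial_succ]; push_cast; ring
    have h0 : (n.factorial : ℝ) ≠ 0 := by positivity
    have h2 : s ^ (n + 1) / (n.factorial : ℝ) = (n + 1) * (s ^ (n + 1) / (n + 1).factorial) := by
      rw [this]
      field_simp
    rw [h2] at ih
    push_cast at h1
    calc _ ≤ _ := add_le_add_left ih _
      _ = s ^ (n + 1) / ((n + 1).factorial : ℝ) *
          ((c + (n + 1)) * ∫ ω, T ω ^ (n + 1) * Real.exp (-s * T ω) ∂μ) := by ring
      _ ≤ _ := h1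
      _ = _ := by ring

lemma antitoneOn_rpow_mul_integral_poissonCDFReal
    (hexp : ∀ s : ℝ, 0 < s → Integrable (fun ω => Real.exp (-s * T ω)) μ) {c : ℝ}
    (hmom : ∀ (k : ℕ) (s : ℝ), 0 < s → (c + k) * ∫ ω, T ω ^ k * Real.exp (-s * T ω) ∂μ ≤
      s * ∫ ω, T ω ^ (k + 1) * Real.exp (-s * T ω) ∂μ) (n : ℕ) :
    AntitoneOn (fun s : ℝ => s ^ c * ∫ ω, poissonCDFReal n (s * T ω) ∂μ) (Set.Ioi 0) := by
  have hd : ∀ s ∈ Set.Ioi (0 : ℝ), HasDerivAt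
      (fun s : ℝ => s ^ c * ∫ ω, poissonCDFReal n (s * T ω) ∂μ) _ s := fun s hs =>
    (Real.hasDerivAt_rpow_const (Or.inl (ne_of_gt hs))).mul
      (hasDerivAt_integral_poissonCDFReal hexp hs n)
  refine antitoneOn_of_deriv_nonpos (convex_Ioi 0)
    (fun s hs => (hd s hs).continuousAt.continuousWithinAt)
    (fun s hs => (hd s (by simpa using hs)).differentiableAt.differentiableWithinAt) ?_
  intro s hs
  have hs0 : 0 < s := by simpa using hs
  rw [(hd s hs0).deriv]
  have h := mul_integral_poissonCDFReal_le hexp hmom hs0 n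
  have h3 : s ^ c = s ^ (c - 1) * s := by
    rw [← Real.rpow_add_one hs0.ne']; simp
  have h4 := mul_le_mul_of_nonneg_left h (Real.rpow_nonneg hs0.le (c - 1))
  rw [h3]
  rw [pow_succ] at h4
  ring_nf at h4 ⊢
  linarith

lemma measure_lt_lt_top
    (hexp : ∀ s : ℝ, 0 < s → Integrable (fun ω => Real.exp (-s * T ω)) μ) (r : ℝ) :
    μ {ω | T ω < r} < ⊤ := by
  refine (measure_mono fun ω hω => ?_).trans_lt
    ((hexp 1 one_pos).measure_ge_lt_top (Real.exp_pos (-r)))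
  simp only [Set.mem_ofPred_eq] at hω ⊢
  gcongr
  linarith

lemma measureReal_lt_mul_rpow_le (hT : Measurable T) (hT0 : ∀ ω, 0 ≤ T ω)
    (hexp : ∀ s : ℝ, 0 < s → Integrable (fun ω => Real.exp (-s * T ω)) μ) {c : ℝ}
    (hmom : ∀ (k : ℕ) (s : ℝ), 0 < s → (c + k) * ∫ ω, T ω ^ k * Real.exp (-s * T ω) ∂μ ≤
      s * ∫ ω, T ω ^ (k + 1) * Real.exp (-s * T ω) ∂μ)
    {r ρ R : ℝ} (hr : 0 < r) (hrρ : r ≤ ρ) (hρR : ρ < R) :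
    (1 / r) ^ c * μ.real {ω | T ω < r} ≤ (1 / ρ) ^ c * μ.real {ω | T ω < R} := by
  have hρ : 0 < ρ := hr.trans_le hrρ
  have hms : ∀ t, MeasurableSet {ω | T ω < t} := fun t => measurableSet_lt hT measurable_const
  have hfin : ∀ t, IsFiniteMeasure (μ.restrict {ω | T ω < t}) := fun t =>
    ⟨by simpa using measure_lt_lt_top hexp t⟩
  have hmeas : ∀ (n : ℕ) (s : ℝ), Measurable fun ω => poissonCDFReal n (s * T ω) := fun n s =>
    (continuous_poissonCDFReal n).measurable.comp (hT.const_mul s)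
  have hlow : Tendsto (fun n : ℕ => ∫ ω in {ω | T ω < r}, poissonCDFReal n (n / r * T ω) ∂μ)
      atTop (𝓝 (μ.real {ω | T ω < r})) := by
    have := hfin r
    have h := tendsto_integral_of_dominated_convergence (μ := μ.restrict {ω | T ω < r})
      (F := fun (n : ℕ) ω => poissonCDFReal n (n / r * T ω)) (f := fun _ => (1 : ℝ))
      (fun _ => 1) (fun n => (hmeas n _).aestronglyMeasurable) (integrable_const _)
      (fun n => Eventually.of_forall fun ω => ?_) ?_
    · simpa using h
    · have : 0 ≤ n / r * T ω := by have := hT0 ω; positivity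
      rw [Real.norm_of_nonneg (poissonCDFReal_nonneg n this)]
      exact poissonCDFReal_le_one n this
    · filter_upwards [ae_restrict_mem (hms r)] with ω hω
      have hx : T ω / r < 1 := (div_lt_one hr).2 hω
      have hx0 : 0 ≤ T ω / r := div_nonneg (hT0 ω) hr.le
      have hlim := (tendsto_mul_exp_one_sub_pow hx0 hx.ne).const_sub 1
      rw [sub_zero] at hlim
      refine tendsto_of_tendsto_of_tendsto_of_le_of_le hlim tendsto_const_nhds (fun n => ?_)
        (fun n => poissonCDFReal_le_one n (by have := hT0 ω; positivity))
      have := one_sub_pow_le_poissonCDFReal n hx0 hx.le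
      rwa [← mul_div_assoc, mul_div_right_comm] at this
  have hup : Tendsto (fun n : ℕ =>
      ∫ ω in {ω | T ω < R}ᶜ, poissonCDFReal (n + 1) ((n + 1 : ℕ) / ρ * T ω) ∂μ)
      atTop (𝓝 0) := by
    have hge : ∀ᵐ ω ∂μ.restrict {ω | T ω < R}ᶜ, 1 < T ω / ρ := by
      filter_upwards [ae_restrict_mem (hms R).compl] with ω hω
      simp only [Set.mem_compl_iff, Set.mem_ofPred_eq, not_lt] at hω
      exact (one_lt_div hρ).2 (hρR.trans_le hω)
    have hbd : Integrable (fun ω => T ω / ρ * Real.exp (1 - T ω / ρ)) μ := by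
      refine ((integrable_pow_mul_exp_neg hexp (inv_pos.2 hρ) 1).const_mul
        (Real.exp 1 / ρ)).congr (Eventually.of_forall fun ω => ?_)
      simp only [sub_eq_add_neg, Real.exp_add]
      rw [show -(T ω / ρ) = -ρ⁻¹ * T ω by ring]
      ring
    have hle : ∀ n : ℕ, ∀ᵐ ω ∂μ.restrict {ω | T ω < R}ᶜ,
        poissonCDFReal (n + 1) ((n + 1 : ℕ) / ρ * T ω) ≤
          (T ω / ρ * Real.exp (1 - T ω / ρ)) ^ (n + 1) := fun n => by
      filter_upwards [hge] with ω hω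
      have := poissonCDFReal_le_pow (n + 1) hω.le
      rwa [← mul_div_assoc, mul_div_right_comm] at this
    have h := tendsto_integral_of_dominated_convergence (μ := μ.restrict {ω | T ω < R}ᶜ)
      (F := fun (n : ℕ) ω => poissonCDFReal (n + 1) ((n + 1 : ℕ) / ρ * T ω))
      (f := fun _ => (0 : ℝ)) (fun ω => T ω / ρ * Real.exp (1 - T ω / ρ))
      (fun n => (hmeas _ _).aestronglyMeasurable) hbd.integrableOn
      (fun n => ?_) ?_
    · simpa using h
    · filter_upwards [hge, hle n] with ω hω hle
      rw [Real.norm_of_nonneg (poissonCDFReal_nonneg _ (by have := hT0 ω; positivity))]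
      refine hle.trans (pow_le_of_le_one (by positivity) ?_ (by omega))
      exact (mul_exp_one_sub_lt_one hω.ne').le
    · filter_upwards [hge, ae_all_iff.2 hle] with ω hω hle
      exact squeeze_zero
        (fun n => poissonCDFReal_nonneg _ (by have := hT0 ω; positivity)) hle
        ((tendsto_add_atTop_iff_nat 1).2 (tendsto_mul_exp_one_sub_pow (by positivity) hω.ne'))
  have hlow' := ((tendsto_add_atTop_iff_nat 1).2 hlow).const_mul ((1 / r) ^ c)
  have hup' := (hup.const_add (μ.real {ω | T ω < R})).const_mul ((1 / ρ) ^ c)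
  rw [add_zero] at hup'
  refine le_of_tendsto_of_tendsto' hlow' hup' fun n => ?_
  have hn : (0 : ℝ) < (n + 1 : ℕ) := by positivity
  have hanti := antitoneOn_rpow_mul_integral_poissonCDFReal hexp hmom (n + 1)
    (show ((n + 1 : ℕ) / ρ : ℝ) ∈ Set.Ioi 0 from div_pos hn hρ)
    (show ((n + 1 : ℕ) / r : ℝ) ∈ Set.Ioi 0 from div_pos hn hr) (by gcongr)
  have e : ∀ t : ℝ, 0 < t → ((n + 1 : ℕ) / t : ℝ) ^ c = ((n + 1 : ℕ) : ℝ) ^ c * (1 / t) ^ c :=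
    fun t ht => by rw [← Real.mul_rpow hn.le (by positivity), mul_one_div]
  simp only [e r hr, e ρ hρ, mul_assoc] at hanti
  have hanti := le_of_mul_le_mul_left hanti (Real.rpow_pos_of_pos hn c)
  have hnn : ∀ t : ℝ, 0 < t → ∀ ω, 0 ≤ poissonCDFReal (n + 1) ((n + 1 : ℕ) / t * T ω) :=
    fun t ht ω => poissonCDFReal_nonneg _ (by have := hT0 ω; positivity)
  calc _ ≤ (1 / r) ^ c * ∫ ω, poissonCDFReal (n + 1) ((n + 1 : ℕ) / r * T ω) ∂μ := by
        refine mul_le_mul_of_nonneg_left ?_ (by positivity)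
        exact setIntegral_le_integral (integrable_poissonCDFReal hexp (div_pos hn hr) _)
          (Eventually.of_forall (hnn r hr))
    _ ≤ _ := hanti
    _ ≤ _ := by
        have hi := integrable_poissonCDFReal hexp (div_pos hn hρ) (n + 1)
        rw [← integral_add_compl (hms R) hi]
        gcongr
        have := hfin R
        calc _ ≤ ∫ ω in {ω | T ω < R}, (1 : ℝ) ∂μ :=
              integral_mono hi.integrableOn (integrable_const _) fun ω =>
                poissonCDFReal_le_one _ (by have := hT0 ω; positivity)
          _ = _ := by simp

/-- If the Laplace moments of `T` satisfy `(c + k) ∫ Tᵏ e^{-sT} ≤ s ∫ Tᵏ⁺¹ e^{-sT}` for all `k`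
and `s > 0`, then `r ↦ μ {T < r} / r ^ c` is non-decreasing. -/
theorem measure_lt_div_rpow_le (hT : Measurable T) (hT0 : ∀ ω, 0 ≤ T ω)
    (hexp : ∀ s : ℝ, 0 < s → Integrable (fun ω => Real.exp (-s * T ω)) μ) {c : ℝ}
    (hmom : ∀ (k : ℕ) (s : ℝ), 0 < s → (c + k) * ∫ ω, T ω ^ k * Real.exp (-s * T ω) ∂μ ≤
      s * ∫ ω, T ω ^ (k + 1) * Real.exp (-s * T ω) ∂μ)
    {r R : ℝ} (hr : 0 < r) (hrR : r ≤ R) :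
    μ {ω | T ω < r} / ENNReal.ofReal (r ^ c) ≤ μ {ω | T ω < R} / ENNReal.ofReal (R ^ c) := by
  rcases hrR.eq_or_lt with rfl | hlt
  · exact le_rfl
  have hR : 0 < R := hr.trans hlt
  have h : (1 / r) ^ c * μ.real {ω | T ω < r} ≤ (1 / R) ^ c * μ.real {ω | T ω < R} := by
    have hcont : ContinuousAt (fun ρ : ℝ => (1 / ρ) ^ c * μ.real {ω | T ω < R}) R := by
      have h1 : ContinuousAt (fun ρ : ℝ => 1 / ρ) R := by
        simpa using continuousAt_inv₀ hR.ne'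
      exact (h1.rpow_const (Or.inl (by positivity))).mul continuousAt_const
    refine ge_of_tendsto (hcont.tendsto.mono_left (nhdsWithin_le_nhds (s := Set.Iio R))) ?_
    filter_upwards [Ioo_mem_nhdsLT hlt] with ρ hρ
    exact measureReal_lt_mul_rpow_le hT hT0 hexp hmom hr hρ.1.le hρ.2
  have e : ∀ t : ℝ, 0 < t → μ {ω | T ω < t} / ENNReal.ofReal (t ^ c) =
      ENNReal.ofReal ((1 / t) ^ c * μ.real {ω | T ω < t}) := fun t ht => by
    rw [one_div, Real.inv_rpow ht.le, mul_comm, ← div_eq_mul_inv,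
      ENNReal.ofReal_div_of_pos (Real.rpow_pos_of_pos ht c),
      ofReal_measureReal (measure_lt_lt_top hexp t).ne]
  rw [e r hr, e R hR]
  exact ENNReal.ofReal_le_ofReal h

end Laplace

section LipProfile

variable {X : Type*} [MetricSpace X]

lemma lip_nonneg (u : X → ℝ) (x : X) : 0 ≤ lip u x := by
  unfold lip
  rcases (𝓝[≠] x).eq_or_neBot with h | h
  · rw [h]
    simp [limsup, limsSup]
  · refine Real.sInf_nonneg fun a ha => ?_
    have ha : ∀ᶠ y in 𝓝[≠] x, |u y - u x| / dist y x ≤ a := ha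
    obtain ⟨y, hy⟩ := ha.exists
    exact le_trans (div_nonneg (abs_nonneg _) dist_nonneg) hy

lemma lip_le_abs_of_hasDerivAt {u : X → ℝ} {f : ℝ → ℝ} {f' : ℝ} {x0 x : X}
    (hf : HasDerivAt f f' (dist x0 x))
    (hu : ∀ y, |u y - u x| ≤ |f (dist x0 y) - f (dist x0 x)|) : lip u x ≤ |f'| := by
  unfold lip
  rcases (𝓝[≠] x).eq_or_neBot with h | h
  · rw [h]
    simp [limsup, limsSup]
  · refine le_of_forall_pos_le_add fun η hη => ?_
    refine limsup_le_of_le (isCoboundedUnder_le_of_le _ (x := 0) fun y => by positivity) ?_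
    have hcont : Tendsto (fun y => dist x0 y) (𝓝[≠] x) (𝓝 (dist x0 x)) :=
      ((continuous_const.dist continuous_id).tendsto x).mono_left nhdsWithin_le_nhds
    filter_upwards [hcont.eventually ((hasDerivAt_iff_isLittleO.1 hf).def hη),
      self_mem_nhdsWithin] with y hy hne
    have hpos : 0 < dist y x := dist_pos.2 hne
    rw [div_le_iff₀ hpos]
    simp only [Real.norm_eq_abs, smul_eq_mul] at hy
    have hd : |dist x0 y - dist x0 x| ≤ dist y x := by
      rw [dist_comm x0 y, dist_comm x0 x]
      exact abs_dist_sub_le y x x0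
    calc |u y - u x| ≤ |f (dist x0 y) - f (dist x0 x)| := hu y
      _ = |(f (dist x0 y) - f (dist x0 x) - (dist x0 y - dist x0 x) * f') +
          (dist x0 y - dist x0 x) * f'| := by rw [sub_add_cancel]
      _ ≤ η * |dist x0 y - dist x0 x| + |dist x0 y - dist x0 x| * |f'| := by
        refine (abs_add_le _ _).trans ?_
        rw [abs_mul (dist x0 y - dist x0 x)]
        gcongr
      _ = (|f'| + η) * |dist x0 y - dist x0 x| := by ring
      _ ≤ (|f'| + η) * dist y x := by gcongr

/-- A bounded-support truncation of `exp (-a d(x0, ·) ^ q)`. -/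
noncomputable def truncExp (x0 : X) (q a ε : ℝ) (x : X) : ℝ :=
  max (Real.exp (-a * dist x0 x ^ q) - ε) 0

lemma truncExp_nonneg (x0 : X) (q a ε : ℝ) (x : X) : 0 ≤ truncExp x0 q a ε x :=
  le_max_right _ _

lemma truncExp_le (x0 : X) (q a : ℝ) {ε : ℝ} (hε : 0 ≤ ε) (x : X) :
    truncExp x0 q a ε x ≤ Real.exp (-a * dist x0 x ^ q) :=
  max_le (by linarith) (Real.exp_pos _).le

lemma continuous_truncExp (x0 : X) {q : ℝ} (hq : 0 ≤ q) (a ε : ℝ) :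
    Continuous (truncExp x0 q a ε) := by
  unfold truncExp
  have : Continuous fun x => dist x0 x ^ q :=
    (continuous_const.dist continuous_id).rpow_const fun _ => Or.inr hq
  fun_prop

lemma abs_truncExp_sub_le (x0 : X) (q a ε : ℝ) (x y : X) :
    |truncExp x0 q a ε y - truncExp x0 q a ε x| ≤
      |Real.exp (-a * dist x0 y ^ q) - Real.exp (-a * dist x0 x ^ q)| := by
  unfold truncExp
  refine (abs_max_sub_max_le_abs _ _ _).trans_eq ?_
  congr 1
  ring

lemma hasDerivAt_exp_neg_mul_rpow {q : ℝ} (hq : 1 ≤ q) (a t : ℝ) :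
    HasDerivAt (fun t : ℝ => Real.exp (-a * t ^ q))
      (Real.exp (-a * t ^ q) * (-a * (q * t ^ (q - 1)))) t :=
  ((Real.hasDerivAt_rpow_const (Or.inr hq)).const_mul (-a)).exp

lemma lip_truncExp_le (x0 : X) {q a : ℝ} (hq : 1 ≤ q) (ha : 0 ≤ a) (ε : ℝ) (x : X) :
    lip (truncExp x0 q a ε) x ≤
      a * q * dist x0 x ^ (q - 1) * Real.exp (-a * dist x0 x ^ q) := by
  refine (lip_le_abs_of_hasDerivAt (hasDerivAt_exp_neg_mul_rpow hq a _)
    (abs_truncExp_sub_le x0 q a ε x)).trans_eq ?_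
  have : 0 ≤ dist x0 x ^ (q - 1) := by positivity
  rw [neg_mul a (q * _), mul_neg, abs_neg, abs_of_nonneg (by positivity)]
  ring

lemma exists_lipschitzWith_truncExp (x0 : X) {q a : ℝ} (hq : 1 ≤ q) (ha : 0 < a) (ε : ℝ) :
    ∃ K : ℝ≥0, LipschitzWith K (truncExp x0 q a ε) := by
  have hbound : ∀ t ∈ Set.Ici (0 : ℝ),
      ‖Real.exp (-a * t ^ q) * (-a * (q * t ^ (q - 1)))‖ ≤ a * q * (1 + 1 / a) := fun t ht => by
    have ht : 0 ≤ t := ht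
    have h1 : t ^ (q - 1) ≤ 1 + t ^ q := by
      rcases le_total t 1 with h | h
      · have := Real.rpow_le_one ht h (sub_nonneg.2 hq)
        have := Real.rpow_nonneg ht q
        linarith
      · have := Real.rpow_le_rpow_of_exponent_le h (sub_le_self q zero_le_one)
        linarith
    have h2 : t ^ q * Real.exp (-a * t ^ q) ≤ 1 / a := by
      rw [le_div_iff₀ ha, neg_mul, Real.exp_neg, mul_right_comm, ← div_eq_mul_inv,
        div_le_one (Real.exp_pos _)]
      linarith [Real.add_one_le_exp (a * t ^ q)]
    have h3 : Real.exp (-a * t ^ q) ≤ 1 := by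
      have : 0 ≤ a * t ^ q := by positivity
      rw [Real.exp_le_one_iff]
      linarith
    have h4 : 0 ≤ t ^ (q - 1) := by positivity
    rw [Real.norm_eq_abs, neg_mul a (q * _), mul_neg, abs_neg, abs_of_nonneg (by positivity)]
    calc _ = a * q * (t ^ (q - 1) * Real.exp (-a * t ^ q)) := by ring
      _ ≤ a * q * ((1 + t ^ q) * Real.exp (-a * t ^ q)) := by gcongr
      _ ≤ _ := by
        rw [add_mul, one_mul]
        gcongr
  obtain ⟨K, hK⟩ : ∃ K : ℝ≥0, (K : ℝ) = a * q * (1 + 1 / a) :=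
    ⟨_, Real.coe_toNNReal _ (by positivity)⟩
  have hL := (convex_Ici (0 : ℝ)).lipschitzOnWith_of_nnnorm_hasDerivWithin_le
    (fun t _ => (hasDerivAt_exp_neg_mul_rpow hq a t).hasDerivWithinAt)
    (fun t ht => NNReal.coe_le_coe.1 ((hbound t ht).trans_eq hK.symm))
  refine ⟨K, LipschitzWith.of_dist_le_mul fun y x => ?_⟩
  rw [Real.dist_eq]
  refine (abs_truncExp_sub_le x0 q a ε x y).trans ?_
  have h := hL.dist_le_mul (dist x0 y) dist_nonneg (dist x0 x) dist_nonneg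
  rw [Real.dist_eq, Real.dist_eq] at h
  refine h.trans ?_
  gcongr
  rw [dist_comm x0 y, dist_comm x0 x]
  exact abs_dist_sub_le y x x0

lemma isBounded_support_truncExp (x0 : X) {q a ε : ℝ} (hq : 0 < q) (ha : 0 < a) (hε : 0 < ε) :
    Bornology.IsBounded (Function.support (truncExp x0 q a ε)) := by
  have hlim : Tendsto (fun t : ℝ => Real.exp (-a * t ^ q)) atTop (𝓝 0) := by
    refine Real.tendsto_exp_atBot.comp ?_
    simpa using (tendsto_rpow_atTop hq).const_mul_atTop_of_neg (neg_lt_zero.2 ha)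
  obtain ⟨N, hN⟩ := eventually_atTop.1 (hlim.eventually_lt_const hε)
  refine (isBounded_ball (x := x0) (r := N)).subset fun x hx => ?_
  by_contra hcon
  rw [mem_ball, dist_comm, not_lt] at hcon
  refine hx (max_eq_right ?_)
  linarith [hN _ hcon]

lemma tendsto_truncExp (x0 : X) (q a : ℝ) (x : X) :
    Tendsto (fun n : ℕ => truncExp x0 q a (1 / (n + 1)) x) atTop
      (𝓝 (Real.exp (-a * dist x0 x ^ q))) := by
  have h : Tendsto (fun n : ℕ => max (Real.exp (-a * dist x0 x ^ q) - 1 / ((n : ℝ) + 1)) 0)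
      atTop (𝓝 (max (Real.exp (-a * dist x0 x ^ q) - 0) 0)) :=
    (tendsto_one_div_add_atTop_nhds_zero_nat.const_sub _).max tendsto_const_nhds
  rwa [sub_zero, max_eq_left (Real.exp_pos _).le] at h

end LipProfile

lemma laplace_moment_le_of_caffarelliKohnNirenberg {X : Type*} [MetricSpace X]
    [MeasurableSpace X] [BorelSpace X] (m : Measure X)
    (x0 : X) (p q : ℝ) (hp : 1 < p) (hq : q = p / (p - 1))
    (hexp : ∀ s : ℝ, 0 < s → Integrable (fun x => Real.exp (-s * dist x0 x ^ q)) m)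
    (C : ℝ) (hC : 0 ≤ C) (k : ℕ)
    (hCKN : ∀ u : X → ℝ, (∃ K : ℝ≥0, LipschitzWith K u) →
      Bornology.IsBounded (Function.support u) →
      (∫ x, dist x0 x ^ (q * k) * (lip u x) ^ p ∂m) *
        (∫ x, dist x0 x ^ (q * (k + 1)) * |u x| ^ p ∂m) ^ (p - 1) ≥
      ((C + k) / (p - 1)) ^ p * (∫ x, dist x0 x ^ (q * k) * |u x| ^ p ∂m) ^ p)
    {s : ℝ} (hs : 0 < s) :
    (C + k) * ∫ x, (dist x0 x ^ q) ^ k * Real.exp (-s * dist x0 x ^ q) ∂m ≤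
      s * ∫ x, (dist x0 x ^ q) ^ (k + 1) * Real.exp (-s * dist x0 x ^ q) ∂m := by
  have hp1 : 0 < p - 1 := sub_pos.2 hp
  have hp0 : 0 < p := by linarith
  have hq1 : 1 ≤ q := by
    rw [hq, le_div_iff₀ hp1]
    linarith
  have hq0 : 0 < q := by linarith
  have hqp : (q - 1) * p = q := by
    rw [hq]
    field_simp
    ring
  set a := s / p with ha_def
  have ha : 0 < a := div_pos hs hp0
  have hexp_rpow : ∀ x, Real.exp (-a * dist x0 x ^ q) ^ p = Real.exp (-s * dist x0 x ^ q) :=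
    fun x => by
      rw [← Real.exp_mul, ha_def]
      congr 1
      field_simp
  have hpow : ∀ (j : ℕ) (x : X), dist x0 x ^ (q * j) = (dist x0 x ^ q) ^ j := fun j x =>
    Real.rpow_mul_natCast dist_nonneg q j
  have hpow' : ∀ (j : ℕ) (x : X), dist x0 x ^ (q * (j + 1)) = (dist x0 x ^ q) ^ (j + 1) :=
    fun j x => by rw [← hpow]; push_cast; rfl
  have hint : ∀ j : ℕ,
      Integrable (fun x => (dist x0 x ^ q) ^ j * Real.exp (-s * dist x0 x ^ q)) m :=
    integrable_pow_mul_exp_neg hexp hs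
  set J : ℕ → ℝ := fun j => ∫ x, (dist x0 x ^ q) ^ j * Real.exp (-s * dist x0 x ^ q) ∂m
    with hJ_def
  have hJ0 : ∀ j, 0 ≤ J j := fun j => integral_nonneg fun x => by positivity
  have habs_le : ∀ (ε : ℝ), 0 ≤ ε → ∀ x,
      |truncExp x0 q a ε x| ^ p ≤ Real.exp (-s * dist x0 x ^ q) := fun ε hε x => by
    rw [← hexp_rpow, abs_of_nonneg (truncExp_nonneg _ _ _ _ _)]
    exact Real.rpow_le_rpow (truncExp_nonneg _ _ _ _ _) (truncExp_le _ _ _ hε _) hp0.le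
  have hlip : ∀ ε : ℝ, ∫ x, dist x0 x ^ (q * k) * (lip (truncExp x0 q a ε) x) ^ p ∂m ≤
      (a * q) ^ p * J (k + 1) := fun ε => by
    rw [hJ_def, ← integral_const_mul]
    refine integral_mono_of_nonneg (Eventually.of_forall fun x => ?_)
      ((hint (k + 1)).const_mul _) (Eventually.of_forall fun x => ?_)
    · have := lip_nonneg (truncExp x0 q a ε) x
      positivity
    · have h1 : (lip (truncExp x0 q a ε) x) ^ p ≤
          (a * q) ^ p * dist x0 x ^ q * Real.exp (-s * dist x0 x ^ q) := by
        refine (Real.rpow_le_rpow (lip_nonneg _ _) (lip_truncExp_le x0 hq1 ha.le ε x)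
          hp0.le).trans_eq ?_
        rw [Real.mul_rpow (by positivity) (Real.exp_pos _).le,
          Real.mul_rpow (by positivity) (by positivity), ← Real.rpow_mul dist_nonneg, hqp,
          hexp_rpow]
      calc _ ≤ dist x0 x ^ (q * k) *
            ((a * q) ^ p * dist x0 x ^ q * Real.exp (-s * dist x0 x ^ q)) :=
          mul_le_mul_of_nonneg_left h1 (by positivity)
        _ = _ := by
          rw [hpow]
          ring
  have hweight : ∀ ε : ℝ, 0 ≤ ε →
      ∫ x, dist x0 x ^ (q * (k + 1)) * |truncExp x0 q a ε x| ^ p ∂m ≤ J (k + 1) :=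
    fun ε hε => by
      refine integral_mono_of_nonneg (Eventually.of_forall fun x => by positivity)
        (hint (k + 1)) (Eventually.of_forall fun x => ?_)
      have := habs_le ε hε x
      simp only [hpow']
      gcongr
  have hlim : Tendsto (fun n : ℕ =>
      ∫ x, dist x0 x ^ (q * k) * |truncExp x0 q a (1 / (n + 1)) x| ^ p ∂m) atTop (𝓝 (J k)) := by
    refine tendsto_integral_of_dominated_convergence _ (fun n => ?_) (hint k)
      (fun n => Eventually.of_forall fun x => ?_) (Eventually.of_forall fun x => ?_)
    · refine Continuous.aestronglyMeasurable ?_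
      exact ((continuous_const.dist continuous_id).rpow_const
        fun _ => Or.inr (by positivity)).mul
        ((continuous_truncExp x0 hq0.le a _).abs.rpow_const fun _ => Or.inr hp0.le)
    · have := habs_le (1 / (n + 1)) (by positivity) x
      rw [Real.norm_of_nonneg (by positivity), hpow]
      gcongr
    · rw [hpow, ← hexp_rpow]
      have h := ((tendsto_truncExp x0 q a x).abs.rpow_const (Or.inr hp0.le)).const_mul
        ((dist x0 x ^ q) ^ k)
      rwa [abs_of_pos (Real.exp_pos _)] at h
  have hmain : ((C + k) / (p - 1)) ^ p * J k ^ p ≤ (a * q) ^ p * J (k + 1) ^ p := by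
    refine le_of_tendsto ((hlim.rpow_const (Or.inr hp0.le)).const_mul _)
      (Eventually.of_forall fun n => ?_)
    have hε : (0 : ℝ) < 1 / (n + 1) := by positivity
    refine (hCKN _ (exists_lipschitzWith_truncExp x0 hq1 ha _)
      (isBounded_support_truncExp x0 hq0 ha hε)).trans ?_
    have e : J (k + 1) ^ p = J (k + 1) * J (k + 1) ^ (p - 1) := by
      rw [← Real.rpow_one_add' (hJ0 _) (by linarith)]
      congr 1
      ring
    rw [e, ← mul_assoc]
    refine mul_le_mul (hlip _) ?_ (by positivity)
      (mul_nonneg (by positivity) (hJ0 _))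
    exact Real.rpow_le_rpow (integral_nonneg fun x => by positivity) (hweight _ hε.le) hp1.le
  have hCk : 0 ≤ (C + k) / (p - 1) := by positivity
  rw [← Real.mul_rpow hCk (hJ0 k), ← Real.mul_rpow (by positivity) (hJ0 (k + 1)),
    Real.rpow_le_rpow_iff (mul_nonneg hCk (hJ0 _)) (mul_nonneg (by positivity) (hJ0 _)) hp0]
    at hmain
  have h := mul_le_mul_of_nonneg_left hmain hp1.le
  have e1 : (p - 1) * ((C + k) / (p - 1) * J k) = (C + k) * J k := by field_simp
  have e2 : (p - 1) * (a * q * J (k + 1)) = s * J (k + 1) := by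
    rw [ha_def, hq]
    field_simp
  rwa [e1, e2] at h

theorem stmt_1 {X : Type*} [MetricSpace X] [CompleteSpace X]
    [TopologicalSpace.SeparableSpace X] [MeasurableSpace X] [BorelSpace X]
    (m : Measure X)
    (hm : ∀ U : Set X, IsOpen U → U.Nonempty → Bornology.IsBounded U → 0 < m U ∧ m U < ⊤)
    (x0 : X) (p p' : ℝ) (hp : 1 < p) (hp' : p' = p / (p - 1))
    (hint : ∀ lam : ℝ, 0 < lam →
      (∫⁻ x, ENNReal.ofReal (Real.exp (-p * lam * dist x0 x ^ p')) ∂m) < ⊤)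
    (C : ℝ) (hC : 0 < C)
    (hCKN : ∀ (k : ℕ) (u : X → ℝ), (∃ K : ℝ≥0, LipschitzWith K u) →
      Bornology.IsBounded (Function.support u) →
      (∫ x, dist x0 x ^ (p' * k) * (lip u x) ^ p ∂m) *
        (∫ x, dist x0 x ^ (p' * (k + 1)) * |u x| ^ p ∂m) ^ (p - 1) ≥
      ((C + k) / (p - 1)) ^ p * (∫ x, dist x0 x ^ (p' * k) * |u x| ^ p ∂m) ^ p)
    (ℓ : ℕ) :
    ∀ r R : ℝ, 0 < r → r ≤ R →
      (m.withDensity fun x => ENNReal.ofReal (dist x0 x ^ (p' * ℓ))) (ball x0 r) /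
        ENNReal.ofReal (r ^ (p' * (C + ℓ))) ≤
      (m.withDensity fun x => ENNReal.ofReal (dist x0 x ^ (p' * ℓ))) (ball x0 R) /
        ENNReal.ofReal (R ^ (p' * (C + ℓ))) := by
  intro r R hr hrR
  have hp1 : 0 < p - 1 := sub_pos.2 hp
  have hp0 : 0 < p := by linarith
  have hq0 : 0 < p' := by
    rw [hp']
    positivity
  have hTc : Continuous fun x => dist x0 x ^ p' :=
    (continuous_const.dist continuous_id).rpow_const fun _ => Or.inr hq0.le
  have hT0 : ∀ x, 0 ≤ dist x0 x ^ p' := fun x => by positivity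
  have hexp : ∀ s : ℝ, 0 < s → Integrable (fun x => Real.exp (-s * dist x0 x ^ p')) m := by
    intro s hs
    have h := (hint (s / p) (by positivity)).ne
    have e : -p * (s / p) = -s := by field_simp
    simp only [e] at h
    exact (lintegral_ofReal_ne_top_iff_integrable
      (Real.continuous_exp.comp (hTc.const_mul (-s))).aestronglyMeasurable
      (Eventually.of_forall fun x => (Real.exp_pos _).le)).1 h
  have hpow : ∀ x, dist x0 x ^ (p' * ℓ) = (dist x0 x ^ p') ^ ℓ := fun x =>
    Real.rpow_mul_natCast dist_nonneg p' ℓ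
  simp only [hpow]
  set w : X → ℝ≥0∞ := fun x => ENNReal.ofReal ((dist x0 x ^ p') ^ ℓ) with hw_def
  have hw : Measurable w := (hTc.pow ℓ).measurable.ennreal_ofReal
  have hw_fin : ∀ᵐ x ∂m, w x < ⊤ := Eventually.of_forall fun x => ENNReal.ofReal_lt_top
  have hw_real : ∀ x, (w x).toReal = (dist x0 x ^ p') ^ ℓ := fun x =>
    ENNReal.toReal_ofReal (by positivity)
  have hmom_eq : ∀ (k : ℕ) (s : ℝ),
      ∫ x, (dist x0 x ^ p') ^ k * Real.exp (-s * dist x0 x ^ p') ∂m.withDensity w =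
        ∫ x, (dist x0 x ^ p') ^ (k + ℓ) * Real.exp (-s * dist x0 x ^ p') ∂m := fun k s => by
    rw [integral_withDensity_eq_integral_toReal_smul hw hw_fin]
    refine integral_congr_ae (Eventually.of_forall fun x => ?_)
    simp only [hw_real, smul_eq_mul]
    ring
  have hmain := measure_lt_div_rpow_le (μ := m.withDensity w) (c := C + ℓ) hTc.measurable hT0
    (fun s hs => ?_) (fun k s hs => ?_) (Real.rpow_pos_of_pos hr p')
    (Real.rpow_le_rpow hr.le hrR hq0.le)
  · have hball : ∀ t : ℝ, 0 < t → {x | dist x0 x ^ p' < t ^ p'} = ball x0 t := fun t ht => by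
      ext x
      rw [mem_ball, dist_comm]
      exact Real.rpow_lt_rpow_iff dist_nonneg ht.le hq0
    rwa [hball r hr, hball R (hr.trans_le hrR), ← Real.rpow_mul hr.le,
      ← Real.rpow_mul (hr.trans_le hrR).le] at hmain
  · rw [integrable_withDensity_iff hw hw_fin]
    refine (integrable_pow_mul_exp_neg hexp hs ℓ).congr (Eventually.of_forall fun x => ?_)
    simp only [hw_real]
    ring
  · rw [hmom_eq, hmom_eq, add_right_comm k 1 ℓ,
      show C + ℓ + k = C + (k + ℓ : ℕ) by push_cast; ring]
    exact laplace_moment_le_of_caffarelliKohnNirenberg m x0 p p' hp hp' hexp C hC.le (k + ℓ)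
      (hCKN (k + ℓ)) hs
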